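/- arXiv:1302.0982 — 2 statements merged into one kernel-verified Lean document; each statement's English description precedes it below -/
import Mathlib

section
/- Let p ≥ 1, s ≥ 2, k ≥ 2, and q ≥ 0 be integers, and let M = Mon⟨a,b : a^p b^{q+s} a^{pk} b^s = b⟩. Writing x for the element of M represented by the word a^{pk} b^s, the equality x b^q x (b^{q+s−1} x)^{k−2} b^{q+s} = b^{q+1} x (b^{q+s−1} x)^{k−1} holds in M. -/
open Relation FreeMonoid

/-- Words over the alphabet `A`: the free monoid on `A`. -/
abbrev Word (A : Type) : Type := FreeMonoid A

/-- One-step rewriting relation of the rewriting system `R`. -/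
def OneStep {A : Type} (R : Set (Word A × Word A)) (x y : Word A) : Prop :=
  ∃ u v l r : Word A, (l, r) ∈ R ∧ x = u * l * v ∧ y = u * r * v

/-- Confluence of the rewriting system `R`. -/
def IsConfluent {A : Type} (R : Set (Word A × Word A)) : Prop :=
  ∀ w x y : Word A, ReflTransGen (OneStep R) w x → ReflTransGen (OneStep R) w y →
    ∃ z : Word A, ReflTransGen (OneStep R) x z ∧ ReflTransGen (OneStep R) y z

/-- Termination of the rewriting system `R`: no infinite rewriting chain. -/
def IsTerminating {A : Type} (R : Set (Word A × Word A)) : Prop :=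
  ¬ ∃ f : ℕ → Word A, ∀ n : ℕ, OneStep R (f n) (f (n + 1))

/-- The monoid presented by generators `A` and relations `R`: the quotient of the
free monoid on `A` by the congruence generated by `R`. -/
abbrev MonPres {A : Type} (R : Set (Word A × Word A)) : Type :=
  (conGen fun x y : Word A => (x, y) ∈ R).Quotient

/-- The canonical projection from words to the presented monoid. -/
def presMk {A : Type} (R : Set (Word A × Word A)) : Word A →* MonPres R :=
  Con.mk' _

/-- A two-letter alphabet. -/
inductive AB : Type | a | b

/-- A three-letter alphabet. -/
inductive ABX : Type | a | b | x


/-- The defining relation of `M = Mon⟨a,b : a^p b^(q+s) a^(pk) b^s = b⟩`. -/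
def relM (p s k q : ℕ) : Set (Word AB × Word AB) :=
  {((of AB.a)^p * (of AB.b)^(q+s) * (of AB.a)^(p*k) * (of AB.b)^s, of AB.b)}

/-- The element of `M` represented by the generator `a`. -/
def Am (p s k q : ℕ) : MonPres (relM p s k q) := presMk _ (of AB.a)

/-- The element of `M` represented by the generator `b`. -/
def Bm (p s k q : ℕ) : MonPres (relM p s k q) := presMk _ (of AB.b)

/-- The element `x` of `M` represented by the word `a^(pk) b^s`. -/
def Xm (p s k q : ℕ) : MonPres (relM p s k q) := presMk _ ((of AB.a)^(p*k) * (of AB.b)^s)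

/-- If `c * b * y = b`, then cancelling `c` against `y` repeatedly gives `c ^ n * b * y ^ n = b`. -/
theorem pow_mul_mul_pow_eq {M : Type*} [Monoid M] {c b y : M} (h : c * b * y = b) (n : ℕ) :
    c ^ n * b * y ^ n = b := by
  induction n with
  | zero => simp
  | succ n ih =>
    calc c ^ (n + 1) * b * y ^ (n + 1) = c ^ n * (c * b * y) * y ^ n := by
          rw [pow_succ, pow_succ']; simp only [mul_assoc]
      _ = b := by rw [h, ih]

/-- The consequence of the relation `c * b ^ (q + s) * (c ^ k * b ^ s) = b` in an arbitrary monoid,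
with `s = t + 1` and `k = m + 2`. -/
theorem mul_pow_mul_eq_of_relation {M : Type*} [Monoid M] {c b x : M} {q t m : ℕ}
    (hx : x = c ^ (m + 2) * b ^ (t + 1)) (h : c * b ^ (q + t + 1) * x = b) :
    x * b ^ q * x * (b ^ (q + t) * x) ^ m * b ^ (q + t + 1) =
      b ^ (q + 1) * x * (b ^ (q + t) * x) ^ (m + 1) := by
  have hy : c * b * (b ^ (q + t) * x) = b := by
    rw [← mul_assoc, mul_assoc c, ← pow_succ', h]
  have hxx : x * b ^ q * x = c ^ (m + 1) * b := by
    calc x * b ^ q * x = c ^ (m + 1) * (c * b ^ (q + t + 1) * x) := by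
          rw [show q + t + 1 = (t + 1) + q by omega, pow_add b (t + 1) q]
          nth_rewrite 1 [hx]
          rw [pow_succ c (m + 1)]
          simp only [mul_assoc]
      _ = c ^ (m + 1) * b := by rw [h]
  have hm : x * b ^ q * x * (b ^ (q + t) * x) ^ m = c * b := by
    rw [hxx, pow_succ', mul_assoc, mul_assoc, ← mul_assoc (c ^ m), pow_mul_mul_pow_eq hy]
  have hb : x * b ^ q * x * (b ^ (q + t) * x) ^ (m + 1) = b := by
    rw [hxx, pow_mul_mul_pow_eq hy]
  calc x * b ^ q * x * (b ^ (q + t) * x) ^ m * b ^ (q + t + 1)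
      = c * b ^ (q + t + 1) * b := by
        rw [hm, mul_assoc, mul_assoc, ← pow_succ', ← pow_succ]
    _ = c * b ^ (q + t + 1) * (x * b ^ q * x * (b ^ (q + t) * x) ^ (m + 1)) := by rw [hb]
    _ = c * b ^ (q + t + 1) * x * b ^ q * x * (b ^ (q + t) * x) ^ (m + 1) := by
        simp only [mul_assoc]
    _ = b ^ (q + 1) * x * (b ^ (q + t) * x) ^ (m + 1) := by rw [h, ← pow_succ']

theorem Xm_eq (p s k q : ℕ) : Xm p s k q = (Am p s k q ^ p) ^ k * Bm p s k q ^ s := by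
  simp [Xm, Am, Bm, pow_mul]

theorem Am_pow_mul_Bm_pow_mul_Xm (p s k q : ℕ) :
    Am p s k q ^ p * Bm p s k q ^ (q + s) * Xm p s k q = Bm p s k q := by
  have h : presMk (relM p s k q) ((of AB.a)^p * (of AB.b)^(q+s) * (of AB.a)^(p*k) * (of AB.b)^s) =
      presMk (relM p s k q) (of AB.b) :=
    (Con.eq _).2 (ConGen.Rel.of _ _ (Set.mem_singleton _))
  simpa [Am, Bm, Xm, mul_assoc] using h

/-- In `M`, the equality `x b^q x (b^(q+s-1) x)^(k-2) b^(q+s) = b^(q+1) x (b^(q+s-1) x)^(k-1)` holds. -/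
theorem stmt10 (p s k q : ℕ) (hp : 1 ≤ p) (hs : 2 ≤ s) (hk : 2 ≤ k) :
    (Xm p s k q) * (Bm p s k q)^q * (Xm p s k q) * ((Bm p s k q)^(q+s-1) * (Xm p s k q))^(k-2) * (Bm p s k q)^(q+s) = (Bm p s k q)^(q+1) * (Xm p s k q) * ((Bm p s k q)^(q+s-1) * (Xm p s k q))^(k-1) := by
  obtain ⟨t, rfl⟩ : ∃ t, s = t + 1 := ⟨s - 1, by omega⟩
  obtain ⟨m, rfl⟩ : ∃ m, k = m + 2 := ⟨k - 2, by omega⟩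
  exact mul_pow_mul_eq_of_relation (Xm_eq p (t + 1) (m + 2) q)
    (Am_pow_mul_Bm_pow_mul_Xm p (t + 1) (m + 2) q)
end

section
/- In the monoid M = Mon⟨a,b : a b² a² b² = b⟩, the equality a b a b² a b = b holds. -/
open Relation FreeMonoid

/-- The defining relation of `M = Mon⟨a,b : a b² a² b² = b⟩`. -/
def rel0 : Set (Word AB × Word AB) :=
  {((of AB.a) * (of AB.b)^2 * (of AB.a)^2 * (of AB.b)^2, of AB.b)}

/-- The element of `M` represented by the generator `a`. -/
def A0 : MonPres rel0 := presMk _ (of AB.a)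

/-- The element of `M` represented by the generator `b`. -/
def B0 : MonPres rel0 := presMk _ (of AB.b)

/-- The defining relation `a b² a² b² = b` holds in `M`. -/
theorem A0_B0_rel : A0 * B0 ^ 2 * A0 ^ 2 * B0 ^ 2 = B0 := by
  have h : presMk rel0 (of AB.a * of AB.b ^ 2 * of AB.a ^ 2 * of AB.b ^ 2) =
      presMk rel0 (of AB.b) :=
    (Con.eq _).2 (ConGen.Rel.of _ _ rfl)
  simpa only [A0, B0, map_mul, map_pow] using h

/-- In any monoid, `a b² a² b² = b` implies `a b a b² a b = b`. -/
theorem mul_eq_of_rel {M : Type*} [Monoid M] {a b : M} (h : a * b ^ 2 * a ^ 2 * b ^ 2 = b) :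
    a * b * a * b ^ 2 * a * b = b :=
  calc
    a * b * a * b ^ 2 * a * b = a * b * a * b ^ 2 * a * (a * b ^ 2 * a ^ 2 * b ^ 2) := by rw [h]
    _ = a * b * (a * b ^ 2 * a ^ 2 * b ^ 2) * a ^ 2 * b ^ 2 := by simp only [pow_two, mul_assoc]
    _ = a * b * b * a ^ 2 * b ^ 2 := by rw [h]
    _ = a * b ^ 2 * a ^ 2 * b ^ 2 := by simp only [pow_two, mul_assoc]
    _ = b := h

/-- In `M`, the equality `a b a b² a b = b` holds. -/
theorem stmt14 : A0 * B0 * A0 * B0^2 * A0 * B0 = B0 :=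
  mul_eq_of_rel A0_B0_rel
end
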